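/- Under the stated setup, the variance term in the bias–variance decomposition equals minus the logarithm of the normalizing constant and is nonnegative: ∫ D_KL(P̄ ‖ P_ω) dμ(ω) = −log Z ≥ 0, where P̄ is the normalized geometric mean with normalizer Z. (This identity is the key step isolating the variance term E_τ[D_KL] in Eq. (10) of the paper.) -/

import Mathlib

open MeasureTheory

/-- Geometric mean of the model probabilities of `y` over the training
distribution: `exp(∫ log P_ω(y) dμ(ω))`. -/
noncomputable def geomMean {Ω Y : Type*} [MeasurableSpace Ω]
    (μ : Measure Ω) (P : Ω → Y → ℝ) (y : Y) : ℝ :=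
  Real.exp (∫ ω, Real.log (P ω y) ∂μ)

/-- Normalizing constant `Z = Σ_y exp(∫ log P_ω(y) dμ(ω))`. -/
noncomputable def Zconst {Ω Y : Type*} [MeasurableSpace Ω] [Fintype Y]
    (μ : Measure Ω) (P : Ω → Y → ℝ) : ℝ :=
  ∑ y, geomMean μ P y

/-- Normalized geometric mean `P̄(y) = exp(∫ log P_ω(y) dμ(ω)) / Z`. -/
noncomputable def geomMeanBar {Ω Y : Type*} [MeasurableSpace Ω] [Fintype Y]
    (μ : Measure Ω) (P : Ω → Y → ℝ) (y : Y) : ℝ :=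
  geomMean μ P y / Zconst μ P

/-- Kullback–Leibler divergence `D_KL(p ‖ q) = Σ_y p(y) log(p(y)/q(y))`. -/
noncomputable def klDiv' {Y : Type*} [Fintype Y] (p q : Y → ℝ) : ℝ :=
  ∑ y, p y * Real.log (p y / q y)

theorem geomMean_pos {Ω Y : Type*} [MeasurableSpace Ω]
    (μ : Measure Ω) (P : Ω → Y → ℝ) (y : Y) : 0 < geomMean μ P y :=
  Real.exp_pos _

theorem Zconst_pos {Ω Y : Type*} [MeasurableSpace Ω] [Fintype Y] [Nonempty Y]
    (μ : Measure Ω) (P : Ω → Y → ℝ) : 0 < Zconst μ P :=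
  Finset.sum_pos (fun y _ => geomMean_pos μ P y) Finset.univ_nonempty

theorem sum_geomMeanBar {Ω Y : Type*} [MeasurableSpace Ω] [Fintype Y] [Nonempty Y]
    (μ : Measure Ω) (P : Ω → Y → ℝ) : ∑ y, geomMeanBar μ P y = 1 := by
  simp only [geomMeanBar, ← Finset.sum_div]
  exact div_self (Zconst_pos μ P).ne'

theorem log_geomMeanBar {Ω Y : Type*} [MeasurableSpace Ω] [Fintype Y] [Nonempty Y]
    (μ : Measure Ω) (P : Ω → Y → ℝ) (y : Y) :
    Real.log (geomMeanBar μ P y) = ∫ ω, Real.log (P ω y) ∂μ - Real.log (Zconst μ P) := by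
  rw [geomMeanBar, Real.log_div (geomMean_pos μ P y).ne' (Zconst_pos μ P).ne', geomMean,
    Real.log_exp]

/-- The geometric mean is at most the arithmetic mean (Jensen's inequality for `exp`). -/
theorem geomMean_le_integral {Ω Y : Type*} [MeasurableSpace Ω]
    (μ : Measure Ω) [IsProbabilityMeasure μ] (P : Ω → Y → ℝ) (y : Y)
    (hpos : ∀ ω, 0 < P ω y) (hint : Integrable (fun ω => P ω y) μ)
    (hlogint : Integrable (fun ω => Real.log (P ω y)) μ) :
    geomMean μ P y ≤ ∫ ω, P ω y ∂μ := by
  have hexp : (Real.exp ∘ fun ω => Real.log (P ω y)) = fun ω => P ω y :=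
    funext fun ω => Real.exp_log (hpos ω)
  calc geomMean μ P y ≤ ∫ ω, Real.exp (Real.log (P ω y)) ∂μ :=
        convexOn_exp.map_integral_le Real.continuous_exp.continuousOn isClosed_univ
          (by simp) hlogint (by rwa [hexp])
    _ = ∫ ω, P ω y ∂μ := by simp only [Real.exp_log (hpos _)]

theorem Zconst_le_one {Ω Y : Type*} [MeasurableSpace Ω] [Fintype Y]
    (μ : Measure Ω) [IsProbabilityMeasure μ] (P : Ω → Y → ℝ)
    (hpos : ∀ ω y, 0 < P ω y) (hsum : ∀ ω, ∑ y, P ω y = 1)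
    (hint : ∀ y, Integrable (fun ω => P ω y) μ)
    (hlogint : ∀ y, Integrable (fun ω => Real.log (P ω y)) μ) :
    Zconst μ P ≤ 1 :=
  calc Zconst μ P ≤ ∑ y, ∫ ω, P ω y ∂μ := Finset.sum_le_sum fun y _ =>
        geomMean_le_integral μ P y (hpos · y) (hint y) (hlogint y)
    _ = ∫ ω, ∑ y, P ω y ∂μ := (integral_finsetSum _ fun y _ => hint y).symm
    _ = 1 := by simp [hsum]

/-- **The variance term equals `−log Z` and is nonnegative.**
For a family of strictly positive probability mass functions `P_ω` on a finite
type `Y`, with `P̄` the normalized geometric mean and `Z` its normalizer,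
`∫ D_KL(P̄ ‖ P_ω) dμ(ω) = −log Z ≥ 0`. -/
theorem integral_klDiv_geomMeanBar_eq_neg_log_normalizer
    {Ω Y : Type*} [MeasurableSpace Ω] [Fintype Y] [Nonempty Y]
    (μ : Measure Ω) [IsProbabilityMeasure μ]
    (P : Ω → Y → ℝ)
    (hpos : ∀ ω y, 0 < P ω y)
    (hsum : ∀ ω, ∑ y, P ω y = 1)
    (hmeas : ∀ y, Measurable fun ω => P ω y)
    (hint : ∀ y, Integrable (fun ω => P ω y) μ)
    (hlogint : ∀ y, Integrable (fun ω => Real.log (P ω y)) μ) :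
    (∫ ω, klDiv' (geomMeanBar μ P) (P ω) ∂μ = -Real.log (Zconst μ P))
      ∧ 0 ≤ -Real.log (Zconst μ P) := by
  refine ⟨?_, neg_nonneg.mpr (Real.log_nonpos (Zconst_pos μ P).le
    (Zconst_le_one μ P hpos hsum hint hlogint))⟩
  have hlog (ω : Ω) (y : Y) : Real.log (geomMeanBar μ P y / P ω y) =
      Real.log (geomMeanBar μ P y) - Real.log (P ω y) :=
    Real.log_div (div_pos (geomMean_pos μ P y) (Zconst_pos μ P)).ne' (hpos ω y).ne'
  have hterm (y : Y) : ∫ ω, geomMeanBar μ P y *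
      (Real.log (geomMeanBar μ P y) - Real.log (P ω y)) ∂μ =
      geomMeanBar μ P y * -Real.log (Zconst μ P) := by
    rw [integral_const_mul, integral_sub (integrable_const _) (hlogint y), integral_const,
      probReal_univ, one_smul, log_geomMeanBar]
    ring
  simp only [klDiv', hlog]
  rw [integral_finsetSum]
  rotate_left
  · exact fun y _ => ((integrable_const _).sub (hlogint y)).const_mul _
  simp only [hterm, ← Finset.sum_mul, sum_geomMeanBar, one_mul]
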